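/- Consider the two-timescale iteration x_{k+1} = x_k + a_k (f(x_k, p_k) − x_k), p_{k+1} = p_k + β_k ∇Φ(x_k)·1{p_k + β_k ∇Φ(x_k) ∈ 𝒫_c}, started at (x₀, p₀) ∈ 𝒳 × 𝒫_c with 0 < c < c*. Under the standing assumptions on G₀ and Φ, assume: f : ℝⁿ × ℝⁿ → ℝⁿ maps 𝒳 × 𝒫_c into 𝒳 and is jointly L_f-Lipschitz there; there is a class-𝒦ℒ function φ such that for every p ∈ 𝒫_c, every solution x(t) of ẋ = f(x, p) − x with x(0) ∈ 𝒳 satisfies ‖x(t) − x*(p)‖ ≤ φ(‖x(0) − x*(p)‖, t) for all t ≥ 0; and the step sizes satisfy a_k ∈ (0,1], β_k > 0, Σ_k a_k = Σ_k β_k = ∞, Σ_k (a_k² + β_k²) < ∞, and β_k / a_k → 0. Then the incentive update is activated persistently: Σ_{k=0}^∞ β_k · 1{p_k + β_k ∇Φ(x_k) ∈ 𝒫_c} = ∞. -/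

import Mathlib

open scoped RealInnerProductSpace
open Filter Topology

/-- Symmetrization `(T + Tᵀ)/2` of a continuous linear map on Euclidean space. -/
noncomputable def symCLM {n : ℕ}
    (T : EuclideanSpace ℝ (Fin n) →L[ℝ] EuclideanSpace ℝ (Fin n)) :
    EuclideanSpace ℝ (Fin n) →L[ℝ] EuclideanSpace ℝ (Fin n) :=
  (1 / 2 : ℝ) • (T + ContinuousLinearMap.adjoint T)

/-- A function `φ : [0,∞) × [0,∞) → [0,∞)` of class 𝒦ℒ. -/
def IsClassKL (φ : ℝ → ℝ → ℝ) : Prop :=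
  (∀ r t, 0 ≤ r → 0 ≤ t → 0 ≤ φ r t) ∧
  (∀ t, 0 ≤ t →
    ContinuousOn (fun r => φ r t) (Set.Ici 0) ∧
    StrictMonoOn (fun r => φ r t) (Set.Ici 0) ∧ φ 0 t = 0) ∧
  (∀ r, 0 ≤ r →
    AntitoneOn (fun t => φ r t) (Set.Ici 0) ∧
    Filter.Tendsto (fun t => φ r t) Filter.atTop (nhds 0))

/-- A bounded Lipschitz autonomous vector field has a solution defined for all times. -/
theorem exists_global_solution {E : Type*} [NormedAddCommGroup E] [NormedSpace ℝ E]
    [CompleteSpace E] {v : E → E} {K M : NNReal} (hv : LipschitzWith K v)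
    (hM : ∀ x, ‖v x‖ ≤ M) (x₀ : E) :
    ∃ ξ : ℝ → E, ξ 0 = x₀ ∧ ∀ t, HasDerivAt ξ (v (ξ t)) t := by
  have hloc : ∀ N : ℕ, ∃ α : ℝ → E, α 0 = x₀ ∧
      ∀ t ∈ Set.Ioo (-(N + 1 : ℝ)) (N + 1), HasDerivAt α (v (α t)) t := by
    intro N
    have h0 : (0 : ℝ) ∈ Set.Icc (-(N + 1 : ℝ)) (N + 1) := by
      constructor <;> linarith [(Nat.cast_nonneg N : (0 : ℝ) ≤ N)]
    have hPL : IsPicardLindelof (fun _ => v) (⟨0, h0⟩ : Set.Icc (-(N + 1 : ℝ)) (N + 1)) x₀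
        (M * (N + 1)) 0 M K := by
      refine IsPicardLindelof.of_time_independent (fun x _ => hM x) hv.lipschitzOnWith ?_
      simp
    obtain ⟨α, hα0, hα⟩ := hPL.exists_eq_forall_mem_Icc_hasDerivWithinAt₀
    exact ⟨α, hα0, fun t ht => (hα t (Set.Ioo_subset_Icc_self ht)).hasDerivAt
      (Icc_mem_nhds ht.1 ht.2)⟩
  choose α hα0 hα using hloc
  have huniq : ∀ N₁ N₂ : ℕ, N₁ ≤ N₂ →
      Set.EqOn (α N₁) (α N₂) (Set.Ioo (-(N₁ + 1 : ℝ)) (N₁ + 1)) := by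
    intro N₁ N₂ hN
    have hN' : (N₁ : ℝ) ≤ N₂ := by exact_mod_cast hN
    refine ODE_solution_unique_of_mem_Ioo (v := fun _ => v) (s := fun _ => Set.univ) (t₀ := 0)
      (K := K) (fun t _ => hv.lipschitzOnWith) ?_ (fun t ht => ⟨hα N₁ t ht, trivial⟩)
      (fun t ht => ⟨hα N₂ t ⟨by linarith [ht.1], by linarith [ht.2]⟩, trivial⟩) ?_
    · constructor <;> linarith [(Nat.cast_nonneg N₁ : (0 : ℝ) ≤ N₁)]
    · rw [hα0, hα0]
  have hglue : ∀ N : ℕ, ∀ t ∈ Set.Ioo (-(N + 1 : ℝ)) (N + 1), α ⌊|t|⌋₊ t = α N t := by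
    intro N t ht
    have hlt := Nat.lt_floor_add_one |t|
    have hle : ⌊|t|⌋₊ ≤ N := by
      refine Nat.lt_succ_iff.1 ((Nat.floor_lt (abs_nonneg t)).2 ?_)
      push_cast
      exact abs_lt.2 ht
    exact huniq _ N hle (abs_lt.1 hlt)
  refine ⟨fun t => α ⌊|t|⌋₊ t, hα0 _, fun t => ?_⟩
  have ht : t ∈ Set.Ioo (-((⌊|t|⌋₊ : ℝ) + 1)) (⌊|t|⌋₊ + 1) :=
    abs_lt.1 (Nat.lt_floor_add_one |t|)
  refine (hα _ t ht).congr_of_eventuallyEq ?_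
  filter_upwards [Ioo_mem_nhds ht.1 ht.2] with s hs using hglue _ s hs

/-- One explicit Euler step for a bounded Lipschitz field has an error quadratic in the step. -/
theorem norm_euler_step_error_le {E : Type*} [NormedAddCommGroup E] [NormedSpace ℝ E]
    {v : E → E} {K M : NNReal} (hv : LipschitzWith K v) (hM : ∀ x, ‖v x‖ ≤ M) {ξ : ℝ → E}
    (hξ : ∀ t, 0 ≤ t → HasDerivAt ξ (v (ξ t)) t) {s h : ℝ} (hs : 0 ≤ s) (hh : 0 ≤ h) :
    ‖ξ (s + h) - ξ s - h • v (ξ s)‖ ≤ K * M * h ^ 2 := by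
  have hlip : ∀ t ∈ Set.Icc s (s + h), ‖ξ t - ξ s‖ ≤ M * h := by
    intro t ht
    have h1 := (convex_Icc s (s + h)).norm_image_sub_le_of_norm_hasDerivWithin_le
      (fun t ht => (hξ t (hs.trans ht.1)).hasDerivWithinAt) (fun t _ => hM (ξ t))
      (Set.left_mem_Icc.2 (by linarith)) ht
    rw [Real.norm_of_nonneg (by linarith [ht.1])] at h1
    refine h1.trans ?_
    have := ht.2
    gcongr
    linarith
  have h2 := (convex_Icc s (s + h)).norm_image_sub_le_of_norm_hasDerivWithin_le
    (f := fun t => ξ t - (t - s) • v (ξ s)) (f' := fun t => v (ξ t) - v (ξ s)) (C := K * (M * h))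
    (fun t ht => by
      have h3 := (hξ t (hs.trans ht.1)).fun_sub
        (((hasDerivAt_id t).sub_const s).smul_const (v (ξ s)))
      simpa using h3.hasDerivWithinAt)
    (fun t ht => (hv.norm_sub_le _ _).trans (by gcongr; exact hlip t ht))
    (Set.left_mem_Icc.2 (by linarith)) (Set.right_mem_Icc.2 (by linarith : s ≤ s + h))
  simp only [add_sub_cancel_left, sub_self, zero_smul, sub_zero, Real.norm_of_nonneg hh] at h2
  calc ‖ξ (s + h) - ξ s - h • v (ξ s)‖ = ‖ξ (s + h) - h • v (ξ s) - ξ s‖ := by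
        congr 1; abel
    _ ≤ K * (M * h) * h := h2
    _ = K * M * h ^ 2 := by ring

/-- A perturbed Euler scheme stays close to the solution of the differential equation started at
the same point, on bounded windows of accumulated step size. -/
theorem norm_perturbed_euler_sub_le {E : Type*} [NormedAddCommGroup E] [NormedSpace ℝ E]
    {v : E → E} {K M : NNReal} (hv : LipschitzWith K v) (hM : ∀ x, ‖v x‖ ≤ M) {ξ : ℝ → E}
    (hξ : ∀ t, 0 ≤ t → HasDerivAt ξ (v (ξ t)) t) {x e : ℕ → E} {a : ℕ → ℝ} {δ : ℝ}
    (hδ : 0 ≤ δ) (ha : ∀ j, 0 ≤ a j) (hx : ∀ j, x (j + 1) = x j + a j • (v (x j) + e j))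
    (hx0 : ξ 0 = x 0) (he : ∀ j, ‖e j‖ + K * M * a j ≤ δ) (j : ℕ) :
    ‖x j - ξ (∑ i ∈ Finset.range j, a i)‖ ≤
      δ * (∑ i ∈ Finset.range j, a i) * Real.exp (K * ∑ i ∈ Finset.range j, a i) := by
  induction j with
  | zero => simp [hx0]
  | succ j ih =>
    rw [Finset.sum_range_succ]
    set s := ∑ i ∈ Finset.range j, a i with hs
    have hs0 : 0 ≤ s := Finset.sum_nonneg fun i _ => ha i
    have hstep := norm_euler_step_error_le hv hM hξ hs0 (ha j)
    have hdecomp : x (j + 1) - ξ (s + a j) = (x j - ξ s) + a j • (v (x j) - v (ξ s)) +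
        a j • e j - (ξ (s + a j) - ξ s - a j • v (ξ s)) := by
      rw [hx, smul_add, smul_sub]; abel
    have hnorm : ‖x (j + 1) - ξ (s + a j)‖ ≤ ‖x j - ξ s‖ + a j * (K * ‖x j - ξ s‖) +
        a j * ‖e j‖ + K * M * a j ^ 2 := by
      rw [hdecomp]
      refine (norm_sub_le _ _).trans (add_le_add ((norm_add_le _ _).trans (add_le_add
        ((norm_add_le _ _).trans (add_le_add le_rfl ?_)) ?_)) hstep)
      · rw [norm_smul, Real.norm_of_nonneg (ha j)]
        exact mul_le_mul_of_nonneg_left (hv.norm_sub_le _ _) (ha j)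
      · rw [norm_smul, Real.norm_of_nonneg (ha j)]
    have hexp1 : 1 + K * a j ≤ Real.exp (K * a j) := by
      linarith [Real.add_one_le_exp (K * a j)]
    have hexp2 : 1 ≤ Real.exp (K * (s + a j)) :=
      Real.one_le_exp (mul_nonneg K.2 (add_nonneg hs0 (ha j)))
    calc ‖x (j + 1) - ξ (s + a j)‖
        ≤ (1 + K * a j) * ‖x j - ξ s‖ + a j * (‖e j‖ + K * M * a j) := by
          refine hnorm.trans_eq ?_; ring
      _ ≤ Real.exp (K * a j) * (δ * s * Real.exp (K * s)) +
            a j * (δ * Real.exp (K * (s + a j))) := by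
          have h1 : ‖e j‖ + K * M * a j ≤ δ * Real.exp (K * (s + a j)) :=
            (he j).trans (le_mul_of_one_le_right hδ hexp2)
          have h2 := ha j
          gcongr
      _ = δ * (s + a j) * Real.exp (K * (s + a j)) := by
          rw [mul_add (K : ℝ), Real.exp_add]; ring

/-- A perturbed Euler scheme with vanishing steps and perturbations converges to an equilibrium
that attracts, uniformly over a set containing the iterates, the solutions of the differential
equation. -/
theorem tendsto_perturbed_euler {E : Type*} [NormedAddCommGroup E] [NormedSpace ℝ E]
    [CompleteSpace E] {v : E → E} {K M : NNReal} (hv : LipschitzWith K v)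
    (hM : ∀ x, ‖v x‖ ≤ M) {S : Set E} {z : E}
    (hattr : ∀ ε > 0, ∃ T : ℝ, 0 ≤ T ∧ ∀ ξ : ℝ → E, ξ 0 ∈ S →
      (∀ t, HasDerivAt ξ (v (ξ t)) t) → ∀ t, T ≤ t → ‖ξ t - z‖ ≤ ε)
    {x e : ℕ → E} {a : ℕ → ℝ} (ha : ∀ j, a j ∈ Set.Ioc (0 : ℝ) 1)
    (hasum : Tendsto (fun N => ∑ k ∈ Finset.range N, a k) atTop atTop)
    (ha0 : Tendsto a atTop (𝓝 0)) (he0 : Tendsto e atTop (𝓝 0))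
    (hxS : ∀ j, x j ∈ S) (hx : ∀ j, x (j + 1) = x j + a j • (v (x j) + e j)) :
    Tendsto x atTop (𝓝 z) := by
  rw [Metric.tendsto_atTop']
  intro ε hε
  obtain ⟨T, hT0, hT⟩ := hattr (ε / 3) (by positivity)
  set C := (T + 1) * Real.exp (K * (T + 1)) with hC
  have hCpos : 0 < C := by positivity
  have hsmall : Tendsto (fun j => ‖e j‖ + K * M * a j) atTop (𝓝 0) := by
    simpa using he0.norm.add (ha0.const_mul (K * M : ℝ))
  have hδ : 0 < ε / 3 / C := by positivity
  obtain ⟨N₀, hN₀⟩ := eventually_atTop.1 (hsmall.eventually (ge_mem_nhds hδ))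
  set s : ℕ → ℝ := fun N => ∑ k ∈ Finset.range N, a k with hs
  obtain ⟨N₁, hN₁⟩ := eventually_atTop.1 (hasum.eventually_ge_atTop (s N₀ + T))
  refine ⟨max N₀ N₁, fun j hj => ?_⟩
  have hjN₀ : N₀ ≤ j := (le_max_left _ _).trans hj.le
  have hjN₁ : s N₀ + T ≤ s j := hN₁ j ((le_max_right _ _).trans hj.le)
  have hex : ∃ k, N₀ ≤ k ∧ k ≤ j ∧ T ≤ s j - s k ∧ s j - s k ≤ T + 1 := by
    classical
    let P : ℕ → Prop := fun k => T ≤ s j - s k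
    have hP : P N₀ := by simp only [P]; linarith
    set k := Nat.findGreatest P j with hk
    refine ⟨k, Nat.le_findGreatest hjN₀ hP, Nat.findGreatest_le j,
      Nat.findGreatest_spec hjN₀ hP, ?_⟩
    rcases (Nat.findGreatest_le (P := P) j).eq_or_lt with h | h
    · rw [← hk] at h
      rw [h]; linarith
    · have h1 : ¬ P (k + 1) := Nat.findGreatest_is_greatest (Nat.lt_succ_self _) h
      have h2 : s (k + 1) = s k + a k := Finset.sum_range_succ _ _
      simp only [P, h2] at h1
      linarith [(ha k).2]
  obtain ⟨k, hk₀, hkj, hk1, hk2⟩ := hex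
  obtain ⟨i, rfl⟩ := Nat.exists_eq_add_of_le hkj
  obtain ⟨ξ, hξ0, hξ⟩ := exists_global_solution hv hM (x k)
  have hsum : ∑ l ∈ Finset.range i, a (k + l) = s (k + i) - s k := by
    simp only [hs, Finset.sum_range_add]; ring
  have hclose := norm_perturbed_euler_sub_le hv hM (fun t _ => hξ t) (x := fun l => x (k + l))
    (e := fun l => e (k + l)) (a := fun l => a (k + l)) hδ.le (fun l => (ha _).1.le)
    (fun l => hx (k + l)) hξ0 (fun l => hN₀ _ (by omega)) i
  rw [hsum] at hclose
  have hbound : ε / 3 / C * (s (k + i) - s k) * Real.exp (K * (s (k + i) - s k)) ≤ ε / 3 := by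
    calc _ ≤ ε / 3 / C * (T + 1) * Real.exp (K * (T + 1)) := by gcongr
      _ = ε / 3 := by rw [mul_assoc, ← hC]; field_simp
  rw [dist_eq_norm]
  calc ‖x (k + i) - z‖ ≤ ‖x (k + i) - ξ (s (k + i) - s k)‖ + ‖ξ (s (k + i) - s k) - z‖ :=
        norm_sub_le_norm_sub_add_norm_sub _ _ _
    _ ≤ ε / 3 + ε / 3 := add_le_add (hclose.trans hbound) (hT ξ (hξ0 ▸ hxS k) hξ _ hk1)
    _ < ε := by linarith

/-- A scalar function whose derivative is nonpositive above a level stays below that level. -/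
theorem le_of_hasDerivAt_nonpos_above {u u' : ℝ → ℝ} {B : ℝ}
    (hu : ∀ t, HasDerivAt u (u' t) t) (h0 : u 0 ≤ B) (hB : ∀ t, B ≤ u t → u' t ≤ 0)
    {t : ℝ} (ht : 0 ≤ t) : u t ≤ B := by
  have key : ∀ ε > 0, u t ≤ B + ε * t := by
    intro ε hε
    refine image_le_of_deriv_right_lt_deriv_boundary (f := u) (f' := u') (a := 0) (b := t)
      (B := fun s => B + ε * s) (B' := fun _ => ε)
      (fun s _ => (hu s).continuousAt.continuousWithinAt)
      (fun s _ => (hu s).hasDerivWithinAt) (by simpa using h0)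
      (fun s => by simpa using ((hasDerivAt_id s).const_mul ε).const_add B) ?_
      (Set.right_mem_Icc.2 ht)
    intro s hs hus
    refine (hB s ?_).trans_lt hε
    rw [hus]
    have := mul_nonneg hε.le hs.1
    linarith
  have hlim : Tendsto (fun ε : ℝ => B + ε * t) (𝓝[>] 0) (𝓝 B) := by
    have : Tendsto (fun ε : ℝ => B + ε * t) (𝓝 0) (𝓝 (B + 0 * t)) :=
      (by fun_prop : Continuous fun ε : ℝ => B + ε * t).tendsto 0
    rw [zero_mul, add_zero] at this
    exact this.mono_left nhdsWithin_le_nhds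
  exact ge_of_tendsto hlim (eventually_mem_nhdsWithin.mono key)

/-- A function decreases along vanishing steps in directions converging to a descent direction of
its strict derivative. -/
theorem HasStrictFDerivAt.eventually_le_add_smul {E : Type*} [NormedAddCommGroup E]
    [NormedSpace ℝ E] {V : E → ℝ} {V' : E →L[ℝ] ℝ} {q g : E} (hV : HasStrictFDerivAt V V' q)
    (hneg : V' g < 0) {p d : ℕ → E} {β : ℕ → ℝ} (hp : Tendsto p atTop (𝓝 q))
    (hd : Tendsto d atTop (𝓝 g)) (hβ : Tendsto β atTop (𝓝 0)) (hβ0 : ∀ k, 0 ≤ β k) :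
    ∀ᶠ k in atTop, V (p k + β k • d k) ≤ V (p k) := by
  have hstep : Tendsto (fun k => p k + β k • d k) atTop (𝓝 q) := by
    simpa using hp.add (hβ.smul hd)
  have hO : (fun k => β k • d k) =O[atTop] β := by
    simpa using (Asymptotics.isBigO_refl β atTop).smul (hd.isBigO_one ℝ)
  have ho : (fun k => V (p k + β k • d k) - V (p k) - V' (β k • d k)) =o[atTop] β := by
    have h1 := hV.isLittleO.comp_tendsto (hstep.prodMk_nhds hp)
    simp only [Function.comp_def, add_sub_cancel_left] at h1
    exact h1.trans_isBigO hO
  have hV'd : Tendsto (fun k => V' (d k)) atTop (𝓝 (V' g)) := (V'.continuous.tendsto g).comp hd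
  filter_upwards [ho.def (show 0 < -(V' g) / 2 by linarith),
    hV'd.eventually (gt_mem_nhds (show V' g < V' g / 2 by linarith))] with k h1 h2
  rw [Real.norm_eq_abs, Real.norm_of_nonneg (hβ0 k), map_smul, smul_eq_mul] at h1
  have h3 := (abs_le.1 h1).2
  have h4 := mul_le_mul_of_nonneg_left h2.le (hβ0 k)
  linarith

/-- A critical point of a convex function is a minimizer. -/
theorem ConvexOn.le_of_hasGradientAt_zero {E : Type*} [NormedAddCommGroup E]
    [InnerProductSpace ℝ E] [CompleteSpace E] {S : Set E} {Φ : E → ℝ} (hΦ : ConvexOn ℝ S Φ)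
    {x y : E} (hx : x ∈ S) (hy : y ∈ S) (hgrad : HasGradientAt Φ 0 x) : Φ x ≤ Φ y := by
  have hline : HasDerivAt (fun t : ℝ => Φ (AffineMap.lineMap x y t)) 0 0 := by
    have h1 : HasFDerivAt Φ (0 : E →L[ℝ] ℝ) (AffineMap.lineMap x y (0 : ℝ)) := by
      simpa using! hgrad.hasFDerivAt
    simpa using! h1.comp_hasDerivAt (0 : ℝ) (AffineMap.hasDerivAt_lineMap (a := x) (b := y))
  have hconv := hΦ.comp_affineMap (AffineMap.lineMap x y : ℝ →ᵃ[ℝ] E)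
  have h := hconv.le_slope_of_hasDerivAt (x := 0) (y := 1) (by simpa using hx) (by simpa using hy)
    one_pos hline
  simpa [slope_def_field] using h

section Box

variable {n : ℕ}

/-- Coordinatewise projection of Euclidean space onto a box. -/
noncomputable def boxClamp (a b : Fin n → ℝ) (x : EuclideanSpace ℝ (Fin n)) :
    EuclideanSpace ℝ (Fin n) :=
  WithLp.toLp 2 fun i => max (a i) (min (x i) (b i))

theorem boxClamp_apply (a b : Fin n → ℝ) (x : EuclideanSpace ℝ (Fin n)) (i : Fin n) :
    boxClamp a b x i = max (a i) (min (x i) (b i)) := rfl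

theorem boxClamp_mem {a b : Fin n → ℝ} (hab : ∀ i, a i ≤ b i) (x : EuclideanSpace ℝ (Fin n)) :
    ∀ i, boxClamp a b x i ∈ Set.Icc (a i) (b i) := fun i =>
  ⟨le_max_left _ _, max_le (hab i) (min_le_right _ _)⟩

theorem boxClamp_of_mem {a b : Fin n → ℝ} {x : EuclideanSpace ℝ (Fin n)}
    (hx : ∀ i, x i ∈ Set.Icc (a i) (b i)) : boxClamp a b x = x := by
  ext i
  rw [boxClamp_apply, min_eq_left (hx i).2, max_eq_right (hx i).1]

theorem lipschitzWith_boxClamp (a b : Fin n → ℝ) : LipschitzWith 1 (boxClamp a b) := by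
  refine LipschitzWith.of_dist_le_mul fun x y => ?_
  rw [NNReal.coe_one, one_mul, EuclideanSpace.dist_eq, EuclideanSpace.dist_eq]
  refine Real.sqrt_le_sqrt (Finset.sum_le_sum fun i _ => ?_)
  rw [Real.dist_eq, Real.dist_eq, boxClamp_apply, boxClamp_apply]
  refine pow_le_pow_left₀ (abs_nonneg _) ?_ 2
  refine (abs_max_sub_max_le_max (a i) _ (a i) _).trans (max_le ?_ ?_)
  · rw [sub_self, abs_zero]; exact abs_nonneg _
  · refine (abs_min_sub_min_le_max (x i) (b i) (y i) (b i)).trans (max_le le_rfl ?_)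
    rw [sub_self, abs_zero]; exact abs_nonneg _

theorem isCompact_box (a b : Fin n → ℝ) :
    IsCompact {x : EuclideanSpace ℝ (Fin n) | ∀ i, x i ∈ Set.Icc (a i) (b i)} := by
  have h := (EuclideanSpace.equiv (Fin n) ℝ).toHomeomorph.isCompact_preimage.2
    (isCompact_univ_pi fun i => isCompact_Icc (a := a i) (b := b i))
  convert h using 1
  ext x
  exact ⟨fun hx i _ => hx i, fun hx i => hx i trivial⟩

theorem convex_box (a b : Fin n → ℝ) :
    Convex ℝ {x : EuclideanSpace ℝ (Fin n) | ∀ i, x i ∈ Set.Icc (a i) (b i)} := by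
  intro x hx y hy s t hs ht hst i
  exact convex_Icc (a i) (b i) (hx i) (hy i) hs ht hst

/-- Solutions of `ξ' = F (π ξ) - π ξ`, where `π` is the projection onto a box preserved by `F`,
stay in the box. -/
theorem mem_box_of_hasDerivAt {a b : Fin n → ℝ} (hab : ∀ i, a i ≤ b i)
    {F : EuclideanSpace ℝ (Fin n) → EuclideanSpace ℝ (Fin n)}
    (hF : ∀ x : EuclideanSpace ℝ (Fin n), (∀ i, x i ∈ Set.Icc (a i) (b i)) →
      ∀ i, F x i ∈ Set.Icc (a i) (b i))
    {ξ : ℝ → EuclideanSpace ℝ (Fin n)} (h0 : ∀ i, ξ 0 i ∈ Set.Icc (a i) (b i))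
    (hξ : ∀ t, HasDerivAt ξ (F (boxClamp a b (ξ t)) - boxClamp a b (ξ t)) t)
    {t : ℝ} (ht : 0 ≤ t) (i : Fin n) : ξ t i ∈ Set.Icc (a i) (b i) := by
  have hcoord : ∀ s, HasDerivAt (fun s => ξ s i)
      (F (boxClamp a b (ξ s)) i - boxClamp a b (ξ s) i) s := fun s => by
    simpa using! (EuclideanSpace.proj (𝕜 := ℝ) i).hasFDerivAt.comp_hasDerivAt s (hξ s)
  have hmem : ∀ s, F (boxClamp a b (ξ s)) i ∈ Set.Icc (a i) (b i) := fun s =>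
    hF _ (boxClamp_mem hab _) i
  constructor
  · refine neg_le_neg_iff.1 (le_of_hasDerivAt_nonpos_above (fun s => (hcoord s).fun_neg)
      (neg_le_neg (h0 i).1) (fun s hs => ?_) ht)
    have h1 : boxClamp a b (ξ s) i = a i := by
      rw [boxClamp_apply, max_eq_left ((min_le_left _ _).trans (neg_le_neg_iff.1 hs))]
    rw [h1]
    linarith [(hmem s).1]
  · refine le_of_hasDerivAt_nonpos_above hcoord (h0 i).2 (fun s hs => ?_) ht
    have h1 : boxClamp a b (ξ s) i = b i := by
      rw [boxClamp_apply, min_eq_right hs, max_eq_right (hab i)]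
    rw [h1]
    linarith [(hmem s).2]

end Box

/-- If the solutions of `y' = F y - y` in a box approach `z` at a rate of class 𝒦ℒ, then every
perturbed Euler scheme for this equation inside the box, with vanishing steps and perturbations,
converges to `z`. -/
theorem tendsto_of_classKL {n : ℕ} {a b : Fin n → ℝ} (hab : ∀ i, a i ≤ b i)
    {S : Set (EuclideanSpace ℝ (Fin n))}
    (hS : S = {x : EuclideanSpace ℝ (Fin n) | ∀ i, x i ∈ Set.Icc (a i) (b i)})
    {F : EuclideanSpace ℝ (Fin n) → EuclideanSpace ℝ (Fin n)} (hF : Set.MapsTo F S S)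
    {L : NNReal} (hFlip : LipschitzOnWith L F S) {z : EuclideanSpace ℝ (Fin n)}
    {φ : ℝ → ℝ → ℝ} (hφ : IsClassKL φ)
    (hKL : ∀ ξ : ℝ → EuclideanSpace ℝ (Fin n), ξ 0 ∈ S →
      (∀ t : ℝ, 0 ≤ t → HasDerivAt ξ (F (ξ t) - ξ t) t) →
      ∀ t : ℝ, 0 ≤ t → ‖ξ t - z‖ ≤ φ ‖ξ 0 - z‖ t)
    {x e : ℕ → EuclideanSpace ℝ (Fin n)} {α : ℕ → ℝ} (hα : ∀ j, α j ∈ Set.Ioc (0 : ℝ) 1)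
    (hαsum : Tendsto (fun N => ∑ k ∈ Finset.range N, α k) atTop atTop)
    (hα0 : Tendsto α atTop (𝓝 0)) (he0 : Tendsto e atTop (𝓝 0)) (hxS : ∀ j, x j ∈ S)
    (hx : ∀ j, x (j + 1) = x j + α j • (F (x j) - x j + e j)) :
    Tendsto x atTop (𝓝 z) := by
  have hScomp : IsCompact S := hS ▸ isCompact_box a b
  obtain ⟨R, hR⟩ := hScomp.isBounded.exists_norm_le
  set π := boxClamp a b with hπ
  have hπS : ∀ y, π y ∈ S := fun y => hS ▸ boxClamp_mem hab y
  have hπid : ∀ y ∈ S, π y = y := fun y hy => by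
    rw [hS] at hy
    exact boxClamp_of_mem hy
  have hR0 : 0 ≤ R := (norm_nonneg _).trans (hR _ (hπS 0))
  have hvlip : LipschitzWith (L + 1) fun y => F (π y) - π y := by
    have h1 := lipschitzWith_boxClamp a b
    have h2 : LipschitzWith (L * 1) fun y => F (π y) :=
      lipschitzOnWith_univ.1 (hFlip.comp (lipschitzOnWith_univ.2 h1) fun y _ => hπS y)
    rw [mul_one] at h2
    exact h2.sub h1
  have hvbd : ∀ y, ‖F (π y) - π y‖ ≤ (Real.toNNReal (R + R) : NNReal) := fun y => by
    rw [Real.coe_toNNReal _ (by positivity)]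
    exact (norm_sub_le _ _).trans (add_le_add (hR _ (hF (hπS y))) (hR _ (hπS y)))
  refine tendsto_perturbed_euler hvlip hvbd (S := S) (fun ε hε => ?_) hα hαsum hα0 he0 hxS
    (fun j => by rw [hx, hπid _ (hxS j)])
  obtain ⟨-, hφr, hφt⟩ := hφ
  have hD : 0 ≤ R + ‖z‖ := by positivity
  obtain ⟨T, hT0, hT⟩ := ((eventually_ge_atTop 0).and
    ((hφt _ hD).2.eventually (ge_mem_nhds hε))).exists
  refine ⟨T, hT0, fun ξ hξ0 hξ t ht => ?_⟩
  have hinS : ∀ s, 0 ≤ s → ξ s ∈ S := fun s hs => by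
    subst hS
    exact fun i => mem_box_of_hasDerivAt hab (fun y hy => hF hy) hξ0 hξ hs i
  have ht0 : 0 ≤ t := hT0.trans ht
  calc ‖ξ t - z‖ ≤ φ ‖ξ 0 - z‖ t := hKL ξ hξ0 (fun s hs => by
        have h := hξ s
        rwa [hπid _ (hinS s hs)] at h) t ht0
    _ ≤ φ (R + ‖z‖) t := (hφr t ht0).2.1.monotoneOn (norm_nonneg _) hD
        ((norm_sub_le _ _).trans (by gcongr; exact hR _ hξ0))
    _ ≤ φ (R + ‖z‖) T := (hφt _ hD).1 hT0 ht0 ht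
    _ ≤ ε := hT

/-- The quadratic form of an operator agrees with that of its symmetrization. -/
theorem inner_symCLM_self {n : ℕ}
    (T : EuclideanSpace ℝ (Fin n) →L[ℝ] EuclideanSpace ℝ (Fin n)) (w : EuclideanSpace ℝ (Fin n)) :
    ⟪w, symCLM T w⟫ = ⟪w, T w⟫ := by
  simp only [symCLM, smul_apply, add_apply,
    inner_smul_right, inner_add_right, ContinuousLinearMap.adjoint_inner_right]
  rw [real_inner_comm w (T w)]
  ring

/-- A coercive operator is invertible. -/
theorem exists_continuousLinearEquiv_of_coercive {E : Type*} [NormedAddCommGroup E]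
    [InnerProductSpace ℝ E] [FiniteDimensional ℝ E] {A : E →L[ℝ] E} {m : ℝ} (hm : 0 < m)
    (hA : ∀ w, m * ‖w‖ ^ 2 ≤ ⟪w, A w⟫) : ∃ e : E ≃L[ℝ] E, (e : E →L[ℝ] E) = A := by
  have hinj : Function.Injective (A : E →ₗ[ℝ] E) := by
    rw [injective_iff_map_eq_zero]
    intro w hw
    have h1 := hA w
    rw [show A w = 0 from hw, inner_zero_right] at h1
    by_contra hne
    have := mul_pos hm (pow_pos (norm_pos_iff.2 hne) 2)
    linarith
  refine ⟨(LinearEquiv.ofInjectiveEndo (A : E →ₗ[ℝ] E) hinj).toContinuousLinearEquiv, ?_⟩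
  ext w
  rfl

theorem stmt13 {n : ℕ} (a b : Fin n → ℝ) (hab : ∀ i, a i < b i)
    (𝒳 : Set (EuclideanSpace ℝ (Fin n)))
    (h𝒳 : 𝒳 = {x : EuclideanSpace ℝ (Fin n) | ∀ i, x i ∈ Set.Icc (a i) (b i)})
    (G₀ : EuclideanSpace ℝ (Fin n) → EuclideanSpace ℝ (Fin n))
    (DG₀ : EuclideanSpace ℝ (Fin n) →
      EuclideanSpace ℝ (Fin n) →L[ℝ] EuclideanSpace ℝ (Fin n))
    (U : Set (EuclideanSpace ℝ (Fin n))) (hU : IsOpen U) (hXU : 𝒳 ⊆ U)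
    (hG₀ : ∀ x ∈ U, HasFDerivAt G₀ (DG₀ x) x)
    (m : ℝ) (hm : 0 < m)
    (hsym : ∀ x ∈ 𝒳, ∀ w, ⟪w, symCLM (DG₀ x) w⟫ ≥ m / 2 * ‖w‖ ^ 2)
    (L₁ : ℝ) (hDG₀lip : ∀ x ∈ 𝒳, ∀ y ∈ 𝒳, ‖DG₀ x - DG₀ y‖ ≤ L₁ * ‖x - y‖)
    -- `x*` is the response map: the inverse of `x ↦ −G₀(x)` from `int 𝒳` onto `𝒫`
    (xstar : EuclideanSpace ℝ (Fin n) → EuclideanSpace ℝ (Fin n))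
    (hmaps : Set.MapsTo xstar ((fun x => -G₀ x) '' interior 𝒳) (interior 𝒳))
    (hinv₁ : ∀ p ∈ (fun x => -G₀ x) '' interior 𝒳, G₀ (xstar p) = -p)
    (hinv₂ : ∀ x ∈ interior 𝒳, xstar (-G₀ x) = x)
    -- the planner's social cost `Φ`
    (Φ : EuclideanSpace ℝ (Fin n) → ℝ)
    (gradΦ : EuclideanSpace ℝ (Fin n) → EuclideanSpace ℝ (Fin n))
    (hΦ : ∀ x, HasGradientAt Φ (gradΦ x) x)
    (μΦ : ℝ) (hμΦ : 0 < μΦ) (hΦconv : StrongConvexOn 𝒳 μΦ Φ)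
    (L₂ : NNReal) (hΦlip : LipschitzOnWith L₂ gradΦ 𝒳)
    (xdag : EuclideanSpace ℝ (Fin n)) (hxdag : xdag ∈ interior 𝒳)
    (hmin : ∀ x ∈ 𝒳, Φ xdag ≤ Φ x)
    -- the sublevel set `𝒫_c` with `0 < c < c*`
    (c : ℝ) (hc0 : 0 < c) (hcstar : c < sInf ((fun x => Φ x - Φ xdag) '' frontier 𝒳))
    (Pc : Set (EuclideanSpace ℝ (Fin n)))
    (hPc : Pc = {p ∈ (fun x => -G₀ x) '' interior 𝒳 | Φ (xstar p) - Φ xdag ≤ c})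
    -- the agents' learning dynamics `f`
    (f : EuclideanSpace ℝ (Fin n) → EuclideanSpace ℝ (Fin n) → EuclideanSpace ℝ (Fin n))
    (hfmaps : ∀ x ∈ 𝒳, ∀ p ∈ Pc, f x p ∈ 𝒳)
    (Lf : NNReal)
    (hflip : LipschitzOnWith Lf
      (fun q : EuclideanSpace ℝ (Fin n) × EuclideanSpace ℝ (Fin n) => f q.1 q.2) (𝒳 ×ˢ Pc))
    (φ : ℝ → ℝ → ℝ) (hφ : IsClassKL φ)
    (hKL : ∀ p ∈ Pc, ∀ ξ : ℝ → EuclideanSpace ℝ (Fin n), ξ 0 ∈ 𝒳 →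
      (∀ t : ℝ, 0 ≤ t → HasDerivAt ξ (f (ξ t) p - ξ t) t) →
      ∀ t : ℝ, 0 ≤ t → ‖ξ t - xstar p‖ ≤ φ ‖ξ 0 - xstar p‖ t)
    -- step sizes
    (ak βk : ℕ → ℝ) (hak : ∀ k, ak k ∈ Set.Ioc (0 : ℝ) 1) (hbk : ∀ k, 0 < βk k)
    (haksum : Tendsto (fun N => ∑ k ∈ Finset.range N, ak k) atTop atTop)
    (hbksum : Tendsto (fun N => ∑ k ∈ Finset.range N, βk k) atTop atTop)
    (hsq : Summable (fun k => ak k ^ 2 + βk k ^ 2))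
    (hratio : Tendsto (fun k => βk k / ak k) atTop (𝓝 0))
    -- the two-timescale iteration
    (x p : ℕ → EuclideanSpace ℝ (Fin n)) (hx0 : x 0 ∈ 𝒳) (hp0 : p 0 ∈ Pc)
    (hxrec : ∀ k, x (k + 1) = x k + ak k • (f (x k) (p k) - x k))
    (hprec : ∀ k, p (k + 1) = p k +
      Set.indicator Pc (fun _ => βk k • gradΦ (x k)) (p k + βk k • gradΦ (x k))) :
    Tendsto (fun N => ∑ k ∈ Finset.range N,
      Set.indicator Pc (fun _ => βk k) (p k + βk k • gradΦ (x k))) atTop atTop := by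
  have hab' : ∀ i, a i ≤ b i := fun i => (hab i).le
  have hXcomp : IsCompact 𝒳 := h𝒳 ▸ isCompact_box a b
  have hXconv : Convex ℝ 𝒳 := h𝒳 ▸ convex_box a b
  have hΦcont : Continuous Φ := continuous_iff_continuousAt.2 fun y => (hΦ y).continuousAt
  have hXint : ∀ y ∈ interior 𝒳, 𝒳 ∈ 𝓝 y := fun y hy => mem_interior_iff_mem_nhds.1 hy
  -- the incentives in `Pc` are the image of a compact sublevel set
  have hsub : ∀ y ∈ 𝒳, Φ y - Φ xdag ≤ c → y ∈ interior 𝒳 := by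
    intro y hy hyc
    by_contra hyi
    have hle : sInf ((fun x => Φ x - Φ xdag) '' frontier 𝒳) ≤ Φ y - Φ xdag := by
      refine csInf_le ⟨0, ?_⟩ ⟨y, ⟨subset_closure hy, hyi⟩, rfl⟩
      rintro _ ⟨u, hu, rfl⟩
      exact sub_nonneg.2 (hmin u (hXcomp.isClosed.frontier_subset hu))
    linarith
  have hPc_image : Pc = (fun x => -G₀ x) '' {y ∈ 𝒳 | Φ y - Φ xdag ≤ c} := by
    rw [hPc]
    ext q
    constructor
    · rintro ⟨⟨y, hy, rfl⟩, hq⟩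
      refine ⟨y, ⟨interior_subset hy, ?_⟩, rfl⟩
      simpa only [hinv₂ y hy] using hq
    · rintro ⟨y, ⟨hy, hyc⟩, rfl⟩
      have hyi := hsub y hy hyc
      exact ⟨⟨y, hyi, rfl⟩, by simpa only [hinv₂ y hyi] using hyc⟩
  have hPc_closed : IsClosed Pc := by
    rw [hPc_image]
    refine IsCompact.isClosed (IsCompact.image_of_continuousOn ?_ fun y hy =>
      (hG₀ y (hXU hy.1)).continuousAt.continuousWithinAt.neg)
    exact hXcomp.inter_right
      (isClosed_le (hΦcont.sub continuous_const) continuous_const)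
  -- the iterates stay in `𝒳` and `Pc`
  have hpmem : ∀ k, p k ∈ Pc := by
    intro k
    induction k with
    | zero => exact hp0
    | succ k ih =>
      rw [hprec]
      by_cases h : p k + βk k • gradΦ (x k) ∈ Pc
      · rwa [Set.indicator_of_mem h]
      · rwa [Set.indicator_of_notMem h, add_zero]
  have hxmem : ∀ k, x k ∈ 𝒳 := by
    intro k
    induction k with
    | zero => exact hx0
    | succ k ih =>
      rw [hxrec]
      exact hXconv.add_smul_sub_mem ih (hfmaps _ ih _ (hpmem k)) ⟨(hak k).1.le, (hak k).2⟩
  -- the step sizes vanish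
  have hak0 : Tendsto ak atTop (𝓝 0) := by
    have h := (Summable.of_nonneg_of_le (fun k => sq_nonneg (ak k))
      (fun k => le_add_of_nonneg_right (sq_nonneg (βk k))) hsq).tendsto_atTop_zero
    simpa only [Real.sqrt_sq (hak _).1.le, Real.sqrt_zero] using h.sqrt
  have hbk0 : Tendsto βk atTop (𝓝 0) := by
    have h := (Summable.of_nonneg_of_le (fun k => sq_nonneg (βk k))
      (fun k => le_add_of_nonneg_left (sq_nonneg (ak k))) hsq).tendsto_atTop_zero
    simpa only [Real.sqrt_sq (hbk _).le, Real.sqrt_zero] using h.sqrt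
  have hind_nonneg : ∀ k, 0 ≤ Set.indicator Pc (fun _ => βk k) (p k + βk k • gradΦ (x k)) :=
    fun k => Set.indicator_nonneg (fun _ _ => (hbk k).le) _
  by_contra hcon
  have hsumm := (summable_iff_not_tendsto_nat_atTop_of_nonneg hind_nonneg).2 hcon
  -- the incentives converge, and the agents follow
  obtain ⟨B, hB⟩ := (hXcomp.image_of_continuousOn hΦlip.continuousOn).isBounded.exists_norm_le
  have hpcauchy : CauchySeq p := by
    refine cauchySeq_of_summable_dist (Summable.of_nonneg_of_le (fun _ => dist_nonneg)
      (fun k => ?_) (hsumm.mul_left B))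
    rw [dist_comm, dist_eq_norm, hprec, add_sub_cancel_left]
    by_cases h : p k + βk k • gradΦ (x k) ∈ Pc
    · rw [Set.indicator_of_mem h, Set.indicator_of_mem h, norm_smul,
        Real.norm_of_nonneg (hbk k).le, mul_comm]
      exact mul_le_mul_of_nonneg_right (hB _ ⟨_, hxmem k, rfl⟩) (hbk k).le
    · simp [Set.indicator_of_notMem h]
  obtain ⟨q, hpq⟩ := cauchySeq_tendsto_of_complete hpcauchy
  have hq : q ∈ Pc := hPc_closed.mem_of_tendsto hpq (Eventually.of_forall hpmem)
  have hxz : Tendsto x atTop (𝓝 (xstar q)) := by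
    refine tendsto_of_classKL hab' h𝒳 (F := fun y => f y q) (fun y hy => hfmaps y hy q hq)
      (L := Lf) ?_ hφ (hKL q hq) (e := fun k => f (x k) (p k) - f (x k) q) hak haksum hak0 ?_
      hxmem fun k => ?_
    · refine LipschitzOnWith.of_dist_le_mul fun y hy y' hy' => ?_
      simpa [Prod.dist_eq] using hflip.dist_le_mul (y, q) ⟨hy, hq⟩ (y', q) ⟨hy', hq⟩
    · refine squeeze_zero_norm (a := fun k => (Lf : ℝ) * dist (p k) q) (fun k => ?_) ?_
      · simpa [Prod.dist_eq, dist_eq_norm] using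
          hflip.dist_le_mul (x k, p k) ⟨hxmem k, hpmem k⟩ (x k, q) ⟨hxmem k, hq⟩
      · simpa using (tendsto_iff_dist_tendsto_zero.1 hpq).const_mul (Lf : ℝ)
    · rw [hxrec]
      congr 2
      abel
  -- local analysis of the social cost at the limiting incentive
  obtain ⟨⟨z, hz, hzq⟩, hqc⟩ : q ∈ (fun x => -G₀ x) '' interior 𝒳 ∧ Φ (xstar q) - Φ xdag ≤ c := by
    rw [hPc] at hq
    exact hq
  obtain rfl : -G₀ z = q := hzq
  rw [hinv₂ z hz] at hxz hqc
  have hzX := interior_subset hz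
  have hDcont : ContinuousAt DG₀ z := by
    refine tendsto_iff_norm_sub_tendsto_zero.2 (squeeze_zero' (g := fun y => L₁ * ‖y - z‖)
      (Eventually.of_forall fun _ => norm_nonneg _)
      (eventually_of_mem (hXint z hz) fun y hy => hDG₀lip y hy z hzX) ?_)
    have h : Continuous fun y => L₁ * ‖y - z‖ := by fun_prop
    simpa using h.tendsto z
  have hGstrict : HasStrictFDerivAt G₀ (DG₀ z) z :=
    hasStrictFDerivAt_of_hasFDerivAt_of_continuousAt
      (eventually_of_mem (hU.mem_nhds (hXU hzX)) hG₀) hDcont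
  have hcoer : ∀ w, m / 2 * ‖w‖ ^ 2 ≤ ⟪w, DG₀ z w⟫ := fun w => by
    rw [← inner_symCLM_self]
    exact hsym z hzX w
  obtain ⟨A, hA⟩ := exists_continuousLinearEquiv_of_coercive (half_pos hm) hcoer
  have hAapp : ∀ w, A w = DG₀ z w := fun w => by rw [← hA]; rfl
  have hnegstrict : HasStrictFDerivAt (fun y => -G₀ y)
      ((A.trans (ContinuousLinearEquiv.neg ℝ) :
        EuclideanSpace ℝ (Fin n) ≃L[ℝ] EuclideanSpace ℝ (Fin n)) :
        EuclideanSpace ℝ (Fin n) →L[ℝ] EuclideanSpace ℝ (Fin n)) z := by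
    have h := hGstrict.fun_neg
    rw [← hA] at h
    exact h
  have hxstar_strict := hnegstrict.to_local_left_inverse (g := xstar)
    (eventually_of_mem (isOpen_interior.mem_nhds hz) hinv₂)
  have himg : (fun y => -G₀ y) '' interior 𝒳 ∈ 𝓝 (-G₀ z) := by
    have h := hnegstrict.map_nhds_eq_of_equiv
    rw [← h]
    exact image_mem_map (isOpen_interior.mem_nhds hz)
  have hgradcont : ContinuousAt gradΦ z := hΦlip.continuousOn.continuousAt (hXint z hz)
  have hgradlim : Tendsto (fun k => gradΦ (x k)) atTop (𝓝 (gradΦ z)) := hgradcont.tendsto.comp hxz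
  have hΦstrict : HasStrictFDerivAt Φ (InnerProductSpace.toDual ℝ _ (gradΦ z)) (xstar (-G₀ z)) := by
    rw [hinv₂ z hz]
    exact hasStrictFDerivAt_of_hasFDerivAt_of_continuousAt
      (f' := fun y => InnerProductSpace.toDual ℝ _ (gradΦ y))
      (Eventually.of_forall fun y => (hΦ y).hasFDerivAt)
      ((InnerProductSpace.toDual ℝ _).continuous.continuousAt.comp hgradcont)
  have hVstrict := hΦstrict.comp _ hxstar_strict
  have hstep : Tendsto (fun k => p k + βk k • gradΦ (x k)) atTop (𝓝 (-G₀ z)) := by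
    simpa using hpq.add (hbk0.smul hgradlim)
  -- the proposed incentive is eventually feasible
  have hcost : ∀ᶠ k in atTop, Φ (xstar (p k + βk k • gradΦ (x k))) - Φ xdag ≤ c := by
    rcases hqc.lt_or_eq with hlt | heq
    · have hlim : Tendsto (fun k => Φ (xstar (p k + βk k • gradΦ (x k))) - Φ xdag) atTop
          (𝓝 (Φ z - Φ xdag)) := by
        have h := (hVstrict.continuousAt.tendsto.comp hstep).sub_const (Φ xdag)
        simpa only [Function.comp_def, hinv₂ z hz] using h
      exact hlim.eventually (ge_mem_nhds hlt)
    · have hgne : gradΦ z ≠ 0 := by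
        intro h0
        have hconv : ConvexOn ℝ 𝒳 Φ := (hΦconv.strictConvexOn hμΦ).convexOn
        have := hconv.le_of_hasGradientAt_zero hzX (interior_subset hxdag) (h0 ▸ hΦ z)
        linarith
      have hneg := hVstrict.eventually_le_add_smul (g := gradΦ z) ?_ hpq hgradlim hbk0
        fun k => (hbk k).le
      · filter_upwards [hneg] with k hk
        have h1 := hpmem k
        rw [hPc] at h1
        exact (sub_le_sub_right hk _).trans h1.2
      · set w := A.symm (gradΦ z) with hw
        have hgw : gradΦ z = A w := by rw [hw, A.apply_symm_apply]
        have hw0 : w ≠ 0 := by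
          rintro h
          rw [h, map_zero] at hgw
          exact hgne hgw
        have hval : (ContinuousLinearEquiv.symm (A.trans (ContinuousLinearEquiv.neg ℝ)))
            (gradΦ z) = -w := by
          rw [ContinuousLinearEquiv.symm_apply_eq]
          simp [hgw]
        have h2 := hcoer w
        have h3 : 0 < m / 2 * ‖w‖ ^ 2 := by positivity
        rw [← hAapp, ← hgw, real_inner_comm] at h2
        simp only [ContinuousLinearMap.comp_apply, ContinuousLinearEquiv.coe_coe, hval,
          InnerProductSpace.toDual_apply_apply, inner_neg_right]
        linarith
  have hactive : ∀ᶠ k in atTop, p k + βk k • gradΦ (x k) ∈ Pc := by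
    filter_upwards [hcost, hstep.eventually himg] with k hk1 hk2
    rw [hPc]
    exact ⟨hk2, hk1⟩
  -- hence the incentive steps are summable, a contradiction
  have hbsumm : Summable βk := by
    refine (summable_congr_atTop ?_).1 hsumm
    filter_upwards [hactive] with k hk using Set.indicator_of_mem hk _
  exact (summable_iff_not_tendsto_nat_atTop_of_nonneg fun k => (hbk k).le).1 hbsumm hbksum
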